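/- Let F̂ be a sub-distribution function on [0,M] with ℓ(F̂) > −∞ that maximizes ℓ over all sub-distribution functions on [0,M]. Then for every sub-distribution function G on [0,M], ∫_0^M (G(t)/F̂(t)) h1(t) dt + ∫_0^M ((1−G(t))/(1−F̂(t))) h2(t) dt + ∫∫_{0≤t<u≤M} ((G(u)−G(t))/(F̂(u)−F̂(t))) h(t,u) dt du ≤ ∫_0^M h1(t) dt + ∫_0^M h2(t) dt + ∫∫_{0≤t<u≤M} h(t,u) dt du, where an integrand is interpreted as 0 at points where the corresponding h-factor vanishes. -/

import Mathlib

open MeasureTheory Set Filter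
open scoped ENNReal NNReal Topology

noncomputable section

/-- `negLogTerm a x` encodes `- a * log x` as a value in `[0,∞]`, with the
conventions `log 0 = -∞` and `0 · (-∞) = 0` (since `0 * ⊤ = 0` in `ℝ≥0∞`). -/
def negLogTerm (a x : ℝ) : ℝ≥0∞ :=
  ENNReal.ofReal a * (if x ≤ 0 then ⊤ else ENNReal.ofReal (- Real.log x))

/-- `negLogLik M h1 h2 h F = - ℓ(F)`, the negative of the smoothed log-likelihood.
Since `h1, h2, h ≥ 0` and `F` takes values in `[0,1]`, all three integrands of `ℓ`
are nonpositive, so `ℓ(F)` is faithfully encoded as minus this `[0,∞]`-valued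
quantity; `ℓ(F) > -∞` iff `negLogLik ≠ ⊤`, and maximizing `ℓ` is minimizing this. -/
def negLogLik (M : ℝ) (h1 h2 : ℝ → ℝ) (h : ℝ → ℝ → ℝ) (F : ℝ → ℝ) : ℝ≥0∞ :=
  (∫⁻ t in Icc (0:ℝ) M, negLogTerm (h1 t) (F t)) +
  (∫⁻ t in Icc (0:ℝ) M, negLogTerm (h2 t) (1 - F t)) +
  ∫⁻ p in (Icc (0:ℝ) M ×ˢ Icc (0:ℝ) M) ∩ {p : ℝ × ℝ | p.1 < p.2},
      negLogTerm (h p.1 p.2) (F p.2 - F p.1)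

/-- A sub-distribution function on `[0,M]`: nondecreasing, `[0,1]`-valued and
right-continuous on `[0,M)`. -/
def IsSubDist (M : ℝ) (F : ℝ → ℝ) : Prop :=
  MonotoneOn F (Icc 0 M) ∧ (∀ t ∈ Icc (0:ℝ) M, F t ∈ Icc (0:ℝ) 1) ∧
    ∀ t ∈ Ico (0:ℝ) M, ContinuousWithinAt F (Ici t) t

/-- `F` maximizes the smoothed log-likelihood `ℓ` over all sub-distribution
functions on `[0,M]` (equivalently, minimizes `negLogLik`). -/
def MaximizesEll (M : ℝ) (h1 h2 : ℝ → ℝ) (h : ℝ → ℝ → ℝ) (F : ℝ → ℝ) : Prop :=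
  ∀ G : ℝ → ℝ, IsSubDist M G → negLogLik M h1 h2 h F ≤ negLogLik M h1 h2 h G

/-- The function `∇_F`. -/
def nabla (M : ℝ) (h1 h2 : ℝ → ℝ) (h : ℝ → ℝ → ℝ) (F : ℝ → ℝ) (u : ℝ) : ℝ :=
  if 0 < F u ∧ F u < 1 then
    h1 u / F u - h2 u / (1 - F u)
      + (∫ v in (0:ℝ)..u, h v u / (F u - F v))
      - ∫ v in u..M, h u v / (F v - F u)
  else 0

lemma measurable_negLogTerm : Measurable fun q : ℝ × ℝ => negLogTerm q.1 q.2 := by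
  unfold negLogTerm
  refine (ENNReal.measurable_ofReal.comp measurable_fst).mul ?_
  exact Measurable.ite (measurableSet_le measurable_snd measurable_const) measurable_const
    (by fun_prop)

lemma neg_log_mix_add_le {x y δ : ℝ} (hx : 0 < x) (hy : 0 ≤ y) (hδ : 0 < δ) (hδ1 : δ < 1) :
    -Real.log ((1 - δ) * x + δ * y) + δ * (y / (x + δ * y)) ≤ -Real.log x + δ / (1 - δ) := by
  have h1δ : 0 < 1 - δ := by linarith
  have hz : 0 < (1 - δ) * x + δ * y := by positivity
  have hlog := Real.one_sub_inv_le_log_of_pos (div_pos hz hx)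
  rw [Real.log_div hz.ne' hx.ne', inv_div] at hlog
  have hsplit : x / ((1 - δ) * x + δ * y) =
      1 - δ * y / ((1 - δ) * x + δ * y) + δ * x / ((1 - δ) * x + δ * y) := by
    field_simp
    ring
  have hy' : δ * (y / (x + δ * y)) ≤ δ * y / ((1 - δ) * x + δ * y) := by
    rw [← mul_div_assoc]
    gcongr
    nlinarith
  have hx' : δ * x / ((1 - δ) * x + δ * y) ≤ δ / (1 - δ) := by
    rw [div_le_div_iff₀ hz h1δ]
    nlinarith [mul_nonneg (mul_nonneg hδ.le hδ.le) hy]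
  linarith

lemma negLogTerm_mix_add_le {w x y δ : ℝ} (hw : 0 ≤ w) (hx1 : x ≤ 1) (hwx : w = 0 ∨ 0 < x)
    (hy : 0 ≤ y) (hy1 : y ≤ 1) (hδ : 0 < δ) (hδ1 : δ < 1) :
    negLogTerm w ((1 - δ) * x + δ * y) + ENNReal.ofReal δ * ENNReal.ofReal (w * (y / (x + δ * y)))
      ≤ negLogTerm w x + ENNReal.ofReal (δ / (1 - δ)) * ENNReal.ofReal w := by
  rcases hwx with rfl | hx
  · simp [negLogTerm]
  have h1δ : 0 < 1 - δ := by linarith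
  have hz : 0 < (1 - δ) * x + δ * y := by positivity
  have hz1 : (1 - δ) * x + δ * y ≤ 1 := by nlinarith
  have hlogz := Real.log_nonpos hz.le hz1
  have hlogx := Real.log_nonpos hx.le hx1
  rw [negLogTerm, negLogTerm, if_neg hz.not_ge, if_neg hx.not_ge, ← ENNReal.ofReal_mul hw,
    ← ENNReal.ofReal_mul hw, ← ENNReal.ofReal_mul hδ.le, ← ENNReal.ofReal_mul (by positivity),
    ← ENNReal.ofReal_add (mul_nonneg hw (by linarith)) (by positivity),
    ← ENNReal.ofReal_add (mul_nonneg hw (by linarith)) (by positivity)]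
  apply ENNReal.ofReal_le_ofReal
  have := mul_le_mul_of_nonneg_left (neg_log_mix_add_le hx hy hδ hδ1) hw
  linarith

section Weighted

variable {X : Type*} [MeasurableSpace X] {μ : Measure X} {w x y : X → ℝ}

lemma ae_eq_zero_or_pos_of_lintegral_negLogTerm_ne_top
    (hwm : AEMeasurable w μ) (hxm : AEMeasurable x μ) (hw : ∀ᵐ a ∂μ, 0 ≤ w a)
    (hfin : ∫⁻ a, negLogTerm (w a) (x a) ∂μ ≠ ⊤) :
    ∀ᵐ a ∂μ, w a = 0 ∨ 0 < x a := by
  have hm : AEMeasurable (fun a => negLogTerm (w a) (x a)) μ :=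
    measurable_negLogTerm.comp_aemeasurable (hwm.prodMk hxm)
  filter_upwards [ae_lt_top' hm hfin, hw] with a ha hwa
  by_contra! hcon
  have hpos : 0 < w a := lt_of_le_of_ne hwa hcon.1.symm
  rw [negLogTerm, if_pos hcon.2, ENNReal.mul_top (by simpa using hpos)] at ha
  exact lt_irrefl _ ha

lemma lintegral_negLogTerm_mix_add_le
    (hwm : AEMeasurable w μ) (hxm : AEMeasurable x μ) (hym : AEMeasurable y μ)
    (hw : ∀ᵐ a ∂μ, 0 ≤ w a) (hx : ∀ᵐ a ∂μ, x a ∈ Icc (0 : ℝ) 1)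
    (hy : ∀ᵐ a ∂μ, y a ∈ Icc (0 : ℝ) 1)
    (hfin : ∫⁻ a, negLogTerm (w a) (x a) ∂μ ≠ ⊤) {δ : ℝ} (hδ : 0 < δ) (hδ1 : δ < 1) :
    ∫⁻ a, negLogTerm (w a) ((1 - δ) * x a + δ * y a) ∂μ +
        ENNReal.ofReal δ * ∫⁻ a, ENNReal.ofReal (w a * (y a / (x a + δ * y a))) ∂μ
      ≤ ∫⁻ a, negLogTerm (w a) (x a) ∂μ +
        ENNReal.ofReal (δ / (1 - δ)) * ∫⁻ a, ENNReal.ofReal (w a) ∂μ := by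
  rw [← lintegral_const_mul'' _ (by fun_prop), ← lintegral_const_mul'' _ (by fun_prop),
    ← lintegral_add_right' _ (by fun_prop), ← lintegral_add_right' _ (by fun_prop)]
  apply lintegral_mono_ae
  filter_upwards [hw, hx, hy, ae_eq_zero_or_pos_of_lintegral_negLogTerm_ne_top hwm hxm hw hfin]
    with a hwa hxa hya hwxa
  exact negLogTerm_mix_add_le hwa hxa.2 hwxa hya.1 hya.2 hδ hδ1

lemma tendsto_lintegral_weighted_ratio
    (hwm : AEMeasurable w μ) (hxm : AEMeasurable x μ) (hym : AEMeasurable y μ)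
    (hw : ∀ᵐ a ∂μ, 0 ≤ w a) (hwx : ∀ᵐ a ∂μ, w a = 0 ∨ 0 < x a) (hy : ∀ᵐ a ∂μ, 0 ≤ y a)
    {δ : ℕ → ℝ} (hδ : ∀ n, 0 < δ n) (hanti : Antitone δ) (hlim : Tendsto δ atTop (𝓝 0)) :
    Tendsto (fun n => ∫⁻ a, ENNReal.ofReal (w a * (y a / (x a + δ n * y a))) ∂μ) atTop
      (𝓝 (∫⁻ a, ENNReal.ofReal (w a * (y a / x a)) ∂μ)) := by
  refine lintegral_tendsto_of_tendsto_of_monotone (fun n => by fun_prop) ?_ ?_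
  · filter_upwards [hw, hwx, hy] with a hwa hwxa hya m n hmn
    rcases hwxa with h0 | hxa
    · simp [h0]
    have := hδ n
    have := hanti hmn
    apply ENNReal.ofReal_le_ofReal
    gcongr
  · filter_upwards [hwx] with a hwxa
    rcases hwxa with h0 | hxa
    · simp [h0]
    apply ENNReal.tendsto_ofReal
    apply Tendsto.const_mul
    refine Tendsto.div tendsto_const_nhds ?_ hxa.ne'
    simpa using tendsto_const_nhds.add (hlim.mul_const (y a))

lemma integral_ratio_eq_toReal
    (hwm : AEMeasurable w μ) (hxm : AEMeasurable x μ) (hym : AEMeasurable y μ)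
    (hw : ∀ᵐ a ∂μ, 0 ≤ w a) (hx : ∀ᵐ a ∂μ, x a ∈ Icc (0 : ℝ) 1)
    (hy : ∀ᵐ a ∂μ, y a ∈ Icc (0 : ℝ) 1) :
    ∫ a, (if w a = 0 then 0 else y a / x a * w a) ∂μ =
      (∫⁻ a, ENNReal.ofReal (w a * (y a / x a)) ∂μ).toReal := by
  have heq : (fun a => if w a = 0 then 0 else y a / x a * w a) =
      fun a => w a * (y a / x a) := by
    funext a
    split_ifs with h0
    · simp [h0]
    · ring
  rw [heq]
  refine integral_eq_lintegral_of_nonneg_ae ?_ ?_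
  · filter_upwards [hw, hx, hy] with a hwa hxa hya
    exact mul_nonneg hwa (div_nonneg hya.1 hxa.1)
  · exact AEMeasurable.aestronglyMeasurable (by fun_prop)

end Weighted

lemma IsSubDist.mix {M δ : ℝ} {F G : ℝ → ℝ} (hF : IsSubDist M F) (hG : IsSubDist M G)
    (hδ : 0 ≤ δ) (hδ1 : δ ≤ 1) : IsSubDist M fun t => (1 - δ) * F t + δ * G t := by
  have h1δ : 0 ≤ 1 - δ := by linarith
  refine ⟨fun s hs t ht hst => ?_, fun t ht => ?_, fun t ht => ?_⟩
  · have := hF.1 hs ht hst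
    have := hG.1 hs ht hst
    dsimp only
    gcongr
  · obtain ⟨hF0, hF1⟩ := hF.2.1 t ht
    obtain ⟨hG0, hG1⟩ := hG.2.1 t ht
    exact ⟨by positivity, by nlinarith⟩
  · exact (continuousWithinAt_const.mul (hF.2.2 t ht)).add
      (continuousWithinAt_const.mul (hG.2.2 t ht))

lemma IsSubDist.exists_measurable_eqOn {M : ℝ} (hM : 0 ≤ M) {F : ℝ → ℝ} (hF : IsSubDist M F) :
    ∃ F' : ℝ → ℝ, Measurable F' ∧ EqOn F' F (Icc 0 M) := by
  refine ⟨IccExtend hM (fun t => F t), ?_, fun t ht => IccExtend_of_mem hM _ ht⟩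
  exact Monotone.measurable
    (Monotone.IccExtend hM fun s t hst => hF.1 s.2 t.2 hst)

lemma ENNReal.le_of_forall_le_mul_of_tendsto {B : ℕ → ℝ≥0∞} {b W : ℝ≥0∞} {δ : ℕ → ℝ}
    (hlim : Tendsto δ atTop (𝓝 0)) (hB : Tendsto B atTop (𝓝 b))
    (hle : ∀ n, B n ≤ ENNReal.ofReal (1 / (1 - δ n)) * W) : b ≤ W := by
  have h1 : Tendsto (fun n => ENNReal.ofReal (1 / (1 - δ n))) atTop (𝓝 1) := by
    rw [← ENNReal.ofReal_one]
    apply ENNReal.tendsto_ofReal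
    simpa using (hlim.const_sub 1).inv₀ (by norm_num)
  have h2 : Tendsto (fun n => ENNReal.ofReal (1 / (1 - δ n)) * W) atTop (𝓝 W) := by
    simpa using ENNReal.Tendsto.mul_const h1 (Or.inl one_ne_zero)
  exact le_of_tendsto_of_tendsto' hB h2 hle

/-- a maximizer `F̂` satisfies, for every sub-distribution function `G`,
the inequality (with integrands interpreted as `0` where the `h`-factor vanishes). -/
theorem stmt_6
    (M ε : ℝ) (hM : 0 < M) (hε : ε ∈ Ioc (0:ℝ) (M / 2))
    (h1 h2 : ℝ → ℝ) (h : ℝ → ℝ → ℝ)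
    (h1cont : ContinuousOn h1 (Icc 0 M)) (h2cont : ContinuousOn h2 (Icc 0 M))
    (h1nn : ∀ t ∈ Icc (0:ℝ) M, 0 ≤ h1 t) (h2nn : ∀ t ∈ Icc (0:ℝ) M, 0 ≤ h2 t)
    (hcont : ContinuousOn (fun p : ℝ × ℝ => h p.1 p.2) (Icc 0 M ×ˢ Icc 0 M))
    (hnn : ∀ t u, t ∈ Icc (0:ℝ) M → u ∈ Icc (0:ℝ) M → 0 ≤ h t u)
    (hsep : ∀ t u : ℝ, u - t < ε → h t u = 0)
    (Fhat : ℝ → ℝ) (hFhat : IsSubDist M Fhat)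
    (hfin : negLogLik M h1 h2 h Fhat ≠ ⊤)
    (hmax : MaximizesEll M h1 h2 h Fhat)
    (G : ℝ → ℝ) (hG : IsSubDist M G) :
    (∫ t in Icc (0:ℝ) M, if h1 t = 0 then 0 else G t / Fhat t * h1 t) +
      (∫ t in Icc (0:ℝ) M, if h2 t = 0 then 0 else (1 - G t) / (1 - Fhat t) * h2 t) +
      (∫ p in (Icc (0:ℝ) M ×ˢ Icc (0:ℝ) M) ∩ {p : ℝ × ℝ | p.1 < p.2},
        if h p.1 p.2 = 0 then 0
        else (G p.2 - G p.1) / (Fhat p.2 - Fhat p.1) * h p.1 p.2) ≤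
    (∫ t in Icc (0:ℝ) M, h1 t) + (∫ t in Icc (0:ℝ) M, h2 t) +
      ∫ p in (Icc (0:ℝ) M ×ˢ Icc (0:ℝ) M) ∩ {p : ℝ × ℝ | p.1 < p.2}, h p.1 p.2 := by
  set S : Set (ℝ × ℝ) := (Icc (0:ℝ) M ×ˢ Icc (0:ℝ) M) ∩ {p : ℝ × ℝ | p.1 < p.2}
  have hSm : MeasurableSet S :=
    (measurableSet_Icc.prod measurableSet_Icc).inter (measurableSet_lt measurable_fst measurable_snd)
  have aeI {P : ℝ → Prop} (hP : ∀ t ∈ Icc (0:ℝ) M, P t) :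
      ∀ᵐ t ∂volume.restrict (Icc (0:ℝ) M), P t :=
    (ae_restrict_mem measurableSet_Icc).mono hP
  have aeS {P : ℝ × ℝ → Prop} (hP : ∀ p ∈ S, P p) : ∀ᵐ p ∂volume.restrict S, P p :=
    (ae_restrict_mem hSm).mono hP
  have subdist_ae {F : ℝ → ℝ} (hF : IsSubDist M F) :
      AEMeasurable F (volume.restrict (Icc 0 M)) ∧
      AEMeasurable (fun p : ℝ × ℝ => F p.2 - F p.1) (volume.restrict S) ∧
      (∀ᵐ p ∂volume.restrict S, F p.2 - F p.1 ∈ Icc (0:ℝ) 1) := by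
    obtain ⟨F', hF'm, hF'⟩ := hF.exists_measurable_eqOn hM.le
    refine ⟨⟨F', hF'm, aeI fun t ht => (hF' ht).symm⟩,
      ⟨fun p => F' p.2 - F' p.1, by fun_prop, aeS fun p hp => ?_⟩, aeS fun p hp => ?_⟩
    · simp only [hF' hp.1.1, hF' hp.1.2]
    · have hmono := hF.1 hp.1.1 hp.1.2 (le_of_lt hp.2)
      have hl := hF.2.1 _ hp.1.1
      have hr := hF.2.1 _ hp.1.2
      exact ⟨by linarith, by linarith [hl.1, hr.2]⟩
  have int1 : IntegrableOn h1 (Icc 0 M) := h1cont.integrableOn_compact isCompact_Icc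
  have int2 : IntegrableOn h2 (Icc 0 M) := h2cont.integrableOn_compact isCompact_Icc
  have int3 : IntegrableOn (fun p : ℝ × ℝ => h p.1 p.2) S :=
    (hcont.integrableOn_compact (isCompact_Icc.prod isCompact_Icc)).mono_set inter_subset_left
  have w1 := aeI h1nn
  have w2 := aeI h2nn
  have w3 : ∀ᵐ p ∂volume.restrict S, 0 ≤ h p.1 p.2 :=
    aeS fun p hp => hnn _ _ hp.1.1 hp.1.2
  have m1 := int1.aemeasurable
  have m2 := int2.aemeasurable
  have m3 := int3.aemeasurable
  obtain ⟨xm1, xm3, xb3⟩ := subdist_ae hFhat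
  obtain ⟨ym1, ym3, yb3⟩ := subdist_ae hG
  have xm2 : AEMeasurable (fun t => 1 - Fhat t) (volume.restrict (Icc 0 M)) := xm1.const_sub 1
  have ym2 : AEMeasurable (fun t => 1 - G t) (volume.restrict (Icc 0 M)) := ym1.const_sub 1
  have xb1 := aeI hFhat.2.1
  have yb1 := aeI hG.2.1
  have compl_mem {c : ℝ} (hc : c ∈ Icc (0:ℝ) 1) : 1 - c ∈ Icc (0:ℝ) 1 :=
    ⟨by linarith [hc.2], by linarith [hc.1]⟩
  have xb2 := xb1.mono fun t ht => compl_mem ht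
  have yb2 := yb1.mono fun t ht => compl_mem ht
  have hfin' := hfin
  simp only [negLogLik, ENNReal.add_ne_top] at hfin'
  obtain ⟨⟨fin1, fin2⟩, fin3⟩ := hfin'
  let δ : ℕ → ℝ := fun n => 1 / ((n : ℝ) + 2)
  have δpos (n : ℕ) : 0 < δ n := by positivity
  have δlt (n : ℕ) : δ n < 1 := by
    simp only [δ]
    rw [div_lt_one (by positivity)]
    linarith [n.cast_nonneg (α := ℝ)]
  have δanti : Antitone δ := fun m n hmn => by
    simp only [δ]
    gcongr
  have δlim : Tendsto δ atTop (𝓝 0) :=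
    tendsto_const_nhds.div_atTop (tendsto_atTop_add_const_right _ _ tendsto_natCast_atTop_atTop)
  have lim1 := tendsto_lintegral_weighted_ratio m1 xm1 ym1 w1
    (ae_eq_zero_or_pos_of_lintegral_negLogTerm_ne_top m1 xm1 w1 fin1)
    (yb1.mono fun _ ht => ht.1) δpos δanti δlim
  have lim2 := tendsto_lintegral_weighted_ratio m2 xm2 ym2 w2
    (ae_eq_zero_or_pos_of_lintegral_negLogTerm_ne_top m2 xm2 w2 fin2)
    (yb2.mono fun _ ht => ht.1) δpos δanti δlim
  have lim3 := tendsto_lintegral_weighted_ratio m3 xm3 ym3 w3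
    (ae_eq_zero_or_pos_of_lintegral_negLogTerm_ne_top m3 xm3 w3 fin3)
    (yb3.mono fun _ ht => ht.1) δpos δanti δlim
  have key := ENNReal.le_of_forall_le_mul_of_tendsto
    (W := (∫⁻ t in Icc (0:ℝ) M, ENNReal.ofReal (h1 t)) +
      (∫⁻ t in Icc (0:ℝ) M, ENNReal.ofReal (h2 t)) + ∫⁻ p in S, ENNReal.ofReal (h p.1 p.2))
    δlim ((lim1.add lim2).add lim3) (fun n => by
      have b1 := lintegral_negLogTerm_mix_add_le m1 xm1 ym1 w1 xb1 yb1 fin1 (δpos n) (δlt n)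
      have b2 := lintegral_negLogTerm_mix_add_le m2 xm2 ym2 w2 xb2 yb2 fin2 (δpos n) (δlt n)
      have b3 := lintegral_negLogTerm_mix_add_le m3 xm3 ym3 w3 xb3 yb3 fin3 (δpos n) (δlt n)
      have hle := hmax _ (hFhat.mix hG (δpos n).le (δlt n).le)
      have e2 (t : ℝ) : 1 - ((1 - δ n) * Fhat t + δ n * G t) =
          (1 - δ n) * (1 - Fhat t) + δ n * (1 - G t) := by ring
      have e3 (p : ℝ × ℝ) : (1 - δ n) * Fhat p.2 + δ n * G p.2 -
          ((1 - δ n) * Fhat p.1 + δ n * G p.1) =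
          (1 - δ n) * (Fhat p.2 - Fhat p.1) + δ n * (G p.2 - G p.1) := by ring
      have hδ0 : ENNReal.ofReal (δ n) ≠ 0 := by simpa using δpos n
      rw [← ENNReal.mul_le_mul_iff_right hδ0 ENNReal.ofReal_ne_top, ← mul_assoc,
        ← ENNReal.ofReal_mul (δpos n).le, mul_one_div, ← ENNReal.add_le_add_iff_left hfin]
      refine (add_le_add_left hle _).trans ?_
      simp only [negLogLik, e2, e3, mul_add]
      convert add_le_add (add_le_add b1 b2) b3 using 1 <;> ring)
  have fin : (∫⁻ t in Icc (0:ℝ) M, ENNReal.ofReal (h1 t)) +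
      (∫⁻ t in Icc (0:ℝ) M, ENNReal.ofReal (h2 t)) + ∫⁻ p in S, ENNReal.ofReal (h p.1 p.2) ≠ ⊤ := by
    simp only [ENNReal.add_ne_top]
    exact ⟨⟨int1.lintegral_lt_top.ne, int2.lintegral_lt_top.ne⟩, int3.lintegral_lt_top.ne⟩
  have finl := ne_top_of_le_ne_top fin key
  have key' := ENNReal.toReal_mono fin key
  simp only [ENNReal.add_ne_top] at fin finl
  obtain ⟨⟨f1, f2⟩, f3⟩ := fin
  obtain ⟨⟨l1, l2⟩, l3⟩ := finl
  rw [ENNReal.toReal_add (ENNReal.add_ne_top.2 ⟨l1, l2⟩) l3, ENNReal.toReal_add l1 l2,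
    ENNReal.toReal_add (ENNReal.add_ne_top.2 ⟨f1, f2⟩) f3, ENNReal.toReal_add f1 f2] at key'
  rw [integral_ratio_eq_toReal m1 xm1 ym1 w1 xb1 yb1,
    integral_ratio_eq_toReal m2 xm2 ym2 w2 xb2 yb2,
    integral_ratio_eq_toReal m3 xm3 ym3 w3 xb3 yb3,
    integral_eq_lintegral_of_nonneg_ae w1 int1.aestronglyMeasurable,
    integral_eq_lintegral_of_nonneg_ae w2 int2.aestronglyMeasurable,
    integral_eq_lintegral_of_nonneg_ae w3 int3.aestronglyMeasurable]
  exact key'
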